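/- arXiv:quant-ph/0111061 — 10 statements merged into one kernel-verified Lean document; each statement's English description precedes it below -/
import Mathlib

section
/- For every finitely supported sequence φ : ℕ → ℂ, the sequence s ↦ i·∑_{s'≠s} φ(s')/(E(s) − E(s')) (a finite sum over the support of φ) is square-summable, i.e. it defines an element of ℓ²(ℕ, ℂ). Hence the characteristic time operator T₁, given by this formula, maps the dense subspace of finitely supported sequences into ℓ²(ℕ, ℂ). -/
theorem stmt0_aux (E : ℕ → ℝ) (hEpos : ∀ s, 0 < E s)
    (hsum : Summable fun s => 1 / (E s) ^ 2) (c : ℂ) (t : ℕ) :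
    Memℓp (fun s => c / ((E s : ℂ) - (E t : ℂ))) 2 := by
  apply memℓp_gen
  have hc : Summable fun s => (4 * ‖c‖ ^ 2) * (1 / (E s) ^ 2) := hsum.mul_left _
  refine Summable.of_norm_bounded_eventually_nat hc ?_
  have ht := hEpos t
  have hpos : 0 < 1 / (2 * E t) ^ 2 := by positivity
  filter_upwards [hsum.tendsto_atTop_zero.eventually (gt_mem_nhds hpos)] with s hs
  have hsp := hEpos s
  have h1 : 2 * E t < E s := by
    rw [one_div_lt_one_div (by positivity) (by positivity)] at hs
    exact lt_of_pow_lt_pow_left₀ 2 hsp.le hs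
  have h2 : ‖(E s : ℂ) - (E t : ℂ)‖ = E s - E t := by
    rw [← Complex.ofReal_sub, Complex.norm_real, Real.norm_of_nonneg (by linarith)]
  have h3 : 0 < E s - E t := by linarith
  simp only [ENNReal.toReal_ofNat, Real.rpow_ofNat, norm_pow, norm_norm, norm_div, h2, Real.norm_of_nonneg h3.le]
  rw [div_pow, mul_one_div, div_le_div_iff₀ (by positivity) (by positivity)]
  have h4 : E s ^ 2 ≤ 4 * (E s - E t) ^ 2 := by nlinarith
  nlinarith [mul_le_mul_of_nonneg_left h4 (sq_nonneg ‖c‖)]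

/-- For every finitely supported sequence `φ : ℕ → ℂ`, the sequence
`s ↦ i·∑_{s'≠s} φ(s')/(E(s) − E(s'))` (a finite sum over the support of `φ`) is
square-summable, i.e. it defines an element of `ℓ²(ℕ, ℂ)`. -/
theorem stmt0 (E : ℕ → ℝ) (hE : StrictMono E) (hEpos : ∀ s, 0 < E s)
    (hsum : Summable fun s => 1 / (E s) ^ 2) (φ : ℕ →₀ ℂ) :
    Memℓp (fun s => Complex.I *
      ∑ s' ∈ φ.support.erase s, φ s' / ((E s : ℂ) - (E s' : ℂ))) 2 := by
  have h := (Memℓp.finsetSum φ.support (p := 2)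
    (f := fun t s => φ t / ((E s : ℂ) - (E t : ℂ)))
    (fun t _ => stmt0_aux E hEpos hsum (φ t) t)).const_mul Complex.I
  have e : (fun s => Complex.I *
      ∑ s' ∈ φ.support.erase s, φ s' / ((E s : ℂ) - (E s' : ℂ))) =
      fun s => Complex.I * ∑ s' ∈ φ.support, φ s' / ((E s : ℂ) - (E s' : ℂ)) := by
    funext s
    congr 1
    exact Finset.sum_erase _ (by simp)
  rw [e]
  exact h
end

section
/- For every N ∈ ℕ there exists a constant A ≥ 0 such that for every sequence φ : ℕ → ℂ supported in {0, 1, …, N}, one has ∑_{s=N+1}^∞ |∑_{s'=0}^{N} φ(s')/(E(s) − E(s'))|² ≤ A · (∑_{s'=0}^{N} |φ(s')|)². -/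
/-- For every `N ∈ ℕ` there exists a constant `A ≥ 0` such that for every
sequence `φ : ℕ → ℂ` supported in `{0, 1, …, N}`, one has
`∑_{s=N+1}^∞ |∑_{s'=0}^{N} φ(s')/(E(s) − E(s'))|² ≤ A · (∑_{s'=0}^{N} |φ(s')|)²`. -/
theorem stmt1 (E : ℕ → ℝ) (hE : StrictMono E) (hEpos : ∀ s, 0 < E s)
    (hsum : Summable fun s => 1 / (E s) ^ 2) (N : ℕ) :
    ∃ A : ℝ, 0 ≤ A ∧ ∀ φ : ℕ → ℂ, (∀ s, N < s → φ s = 0) →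
      Summable (fun s : {s : ℕ // N < s} =>
        ‖∑ s' ∈ Finset.range (N + 1), φ s' / ((E (s : ℕ) : ℂ) - (E s' : ℂ))‖ ^ 2) ∧
      (∑' s : {s : ℕ // N < s},
          ‖∑ s' ∈ Finset.range (N + 1), φ s' / ((E (s : ℕ) : ℂ) - (E s' : ℂ))‖ ^ 2) ≤
        A * (∑ s' ∈ Finset.range (N + 1), ‖φ s'‖) ^ 2 := by
  have h1 : E N < E (N + 1) := hE (Nat.lt_succ_self N)
  have hN := hEpos N
  have hN1 := hEpos (N + 1)
  obtain ⟨c, hc⟩ : ∃ c : ℝ, c = 1 - E N / E (N + 1) := ⟨_, rfl⟩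
  have hc0 : 0 < c := by
    rw [hc, sub_pos, div_lt_one hN1]; exact h1
  have key : ∀ s s' : ℕ, N < s → s' ≤ N → c * E s ≤ E s - E s' := by
    intro s s' hs hs'
    have h2 : E s' ≤ E N := hE.monotone hs'
    have h3 : E (N + 1) ≤ E s := hE.monotone hs
    have h4 : E N ≤ E N / E (N + 1) * E s := by
      rw [div_mul_eq_mul_div, le_div_iff₀ hN1]
      exact mul_le_mul_of_nonneg_left h3 hN.le
    rw [hc]; linarith
  have hsub : Summable (fun s : {s : ℕ // N < s} => 1 / (E (s : ℕ)) ^ 2) :=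
    hsum.subtype {s : ℕ | N < s}
  refine ⟨(1 / c ^ 2) * ∑' s : {s : ℕ // N < s}, 1 / (E (s : ℕ)) ^ 2,
    mul_nonneg (by positivity) (tsum_nonneg fun s => by positivity), ?_⟩
  intro φ _
  obtain ⟨S, hS⟩ : ∃ S : ℝ, S = ∑ s' ∈ Finset.range (N + 1), ‖φ s'‖ := ⟨_, rfl⟩
  rw [← hS]
  have hb : ∀ s : {s : ℕ // N < s},
      ‖∑ s' ∈ Finset.range (N + 1), φ s' / ((E (s : ℕ) : ℂ) - (E s' : ℂ))‖ ^ 2 ≤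
        (1 / c ^ 2 * S ^ 2) * (1 / (E (s : ℕ)) ^ 2) := by
    rintro ⟨s, hs⟩
    have hcs : 0 < c * E s := mul_pos hc0 (hEpos s)
    have h5 : ‖∑ s' ∈ Finset.range (N + 1), φ s' / ((E s : ℂ) - (E s' : ℂ))‖ ≤
        S / (c * E s) := by
      rw [hS, Finset.sum_div]
      refine norm_sum_le_of_le _ fun s' hs' => ?_
      have h6 := key s s' hs (Nat.lt_succ_iff.mp (Finset.mem_range.mp hs'))
      rw [norm_div, ← Complex.ofReal_sub, Complex.norm_real, Real.norm_eq_abs,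
        abs_of_pos (hcs.trans_le h6)]
      exact div_le_div_of_nonneg_left (norm_nonneg _) hcs h6
    calc _ ≤ (S / (c * E s)) ^ 2 := pow_le_pow_left₀ (norm_nonneg _) h5 2
      _ = _ := by
        have := (hEpos s).ne'
        field_simp
  have hs2 := hsub.mul_left (1 / c ^ 2 * S ^ 2)
  have hs1 := Summable.of_nonneg_of_le (fun s => by positivity) hb hs2
  refine ⟨hs1, (hs1.tsum_le_tsum hb hs2).trans (le_of_eq ?_)⟩
  rw [tsum_mul_left]
  ring
end

section
/- Let φ : ℕ → ℂ be finitely supported with ∑_s φ(s) = 0. Then for every s ∈ ℕ, i·∑_{s'≠s} E(s')·φ(s')/(E(s) − E(s')) − E(s)·( i·∑_{s'≠s} φ(s')/(E(s) − E(s')) ) = i·φ(s). In other words, (T₁H₁ − H₁T₁)φ = iφ on such vectors, where H₁ is coordinatewise multiplication by E and T₁ has matrix elements i/(E(s) − E(s')) off the diagonal. -/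
/-- Let `φ : ℕ → ℂ` be finitely supported with `∑_s φ(s) = 0`. Then for every
`s ∈ ℕ`, `i·∑_{s'≠s} E(s')·φ(s')/(E(s) − E(s')) − E(s)·(i·∑_{s'≠s} φ(s')/(E(s) − E(s')))
= i·φ(s)`; i.e. `(T₁H₁ − H₁T₁)φ = iφ` on such vectors. -/
theorem stmt2 (E : ℕ → ℝ) (hE : StrictMono E) (hEpos : ∀ s, 0 < E s)
    (φ : ℕ →₀ ℂ) (hφ : ∑ s ∈ φ.support, φ s = 0) (s : ℕ) :
    Complex.I * (∑ s' ∈ φ.support.erase s, (E s' : ℂ) * φ s' / ((E s : ℂ) - (E s' : ℂ))) -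
      (E s : ℂ) * (Complex.I * ∑ s' ∈ φ.support.erase s, φ s' / ((E s : ℂ) - (E s' : ℂ))) =
      Complex.I * φ s := by
  have h1 : ∑ s' ∈ φ.support.erase s, φ s' = -φ s := by
    by_cases hs : s ∈ φ.support
    · have h := Finset.sum_erase_add φ.support (fun x => φ x) hs
      simp only [hφ] at h
      exact eq_neg_of_add_eq_zero_left h
    · rw [Finset.erase_eq_of_notMem hs, hφ, Finsupp.notMem_support_iff.mp hs, neg_zero]
  have h2 : (∑ s' ∈ φ.support.erase s, (E s' : ℂ) * φ s' / ((E s : ℂ) - (E s' : ℂ))) -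
      (E s : ℂ) * ∑ s' ∈ φ.support.erase s, φ s' / ((E s : ℂ) - (E s' : ℂ)) = φ s := by
    rw [Finset.mul_sum, ← Finset.sum_sub_distrib, ← neg_eq_iff_eq_neg.mpr h1,
      ← Finset.sum_neg_distrib]
    refine Finset.sum_congr rfl fun x hx => ?_
    have hne : (E s : ℂ) - (E x : ℂ) ≠ 0 := by
      rw [sub_ne_zero]
      intro h
      exact (Finset.mem_erase.mp hx).1 (hE.injective (Complex.ofReal_injective h)).symm
    field_simp
    ring
  linear_combination Complex.I * h2
end

section
/- Let φ : ℕ → ℂ be finitely supported with ∑_s φ(s) = 0. Then the sequence s ↦ E(s)·( i·∑_{s'≠s} φ(s')/(E(s) − E(s')) ) is square-summable, i.e. belongs to ℓ²(ℕ, ℂ). In other words, T₁φ lies in the domain of the Hamiltonian H₁ (multiplication by E), so φ belongs to the domain of H₁T₁. -/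
/-- Let `φ : ℕ → ℂ` be finitely supported with `∑_s φ(s) = 0`. Then the sequence
`s ↦ E(s)·(i·∑_{s'≠s} φ(s')/(E(s) − E(s')))` is square-summable, i.e. `T₁φ` lies in the
domain of the Hamiltonian `H₁`, so `φ` belongs to the domain of `H₁T₁`. -/
theorem stmt5 (E : ℕ → ℝ) (hE : StrictMono E) (hEpos : ∀ s, 0 < E s)
    (hsum : Summable fun s => 1 / (E s) ^ 2)
    (φ : ℕ →₀ ℂ) (hφ : ∑ s ∈ φ.support, φ s = 0) :
    Memℓp (fun s => (E s : ℂ) *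
      (Complex.I * ∑ s' ∈ φ.support.erase s, φ s' / ((E s : ℂ) - (E s' : ℂ)))) 2 := by
  have hlim := hsum.tendsto_atTop_zero
  have hbig : ∀ c : ℝ, 0 < c → ∀ᶠ s in Filter.atTop, 2 * c < E s := by
    intro c hc
    have h4 : (0 : ℝ) < 1 / (2 * c) ^ 2 := by positivity
    filter_upwards [hlim.eventually (gt_mem_nhds h4)] with s hs
    have h1 := (one_div_lt_one_div (pow_pos (hEpos s) 2) (by positivity)).1 hs
    exact lt_of_pow_lt_pow_left₀ 2 (hEpos s).le h1
  have hterm : ∀ s' ∈ φ.support,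
      (fun s => φ s' * (E s' : ℂ) / ((E s : ℂ) - (E s' : ℂ))) =O[Filter.atTop]
        (fun s => 1 / E s) := by
    intro s' _
    refine Asymptotics.IsBigO.of_bound (2 * ‖φ s' * (E s' : ℂ)‖) ?_
    filter_upwards [hbig (E s') (hEpos s')] with s hs
    have hp := hEpos s
    have hp' := hEpos s'
    have hd : 0 < E s - E s' := by linarith
    rw [norm_div, ← Complex.ofReal_sub, Complex.norm_real, Real.norm_of_nonneg hd.le,
      Real.norm_of_nonneg (by positivity), mul_one_div, div_le_div_iff₀ hd hp]
    have := norm_nonneg (φ s' * (E s' : ℂ))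
    nlinarith
  have hO : (fun s => (E s : ℂ) * (Complex.I * ∑ s' ∈ φ.support.erase s,
      φ s' / ((E s : ℂ) - (E s' : ℂ)))) =O[Filter.atTop] (fun s => 1 / E s) := by
    have h := (Asymptotics.IsBigO.sum hterm).const_mul_left Complex.I
    refine h.congr' ?_ Filter.EventuallyEq.rfl
    have hev : ∀ᶠ s in Filter.atTop, s ∉ φ.support := by
      rw [← Nat.cofinite_eq_atTop]
      exact φ.support.finite_toSet.compl_mem_cofinite
    filter_upwards [hev] with s hs
    rw [Finset.erase_eq_of_notMem hs, mul_left_comm]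
    congr 1
    rw [Finset.sum_apply, ← add_zero (∑ i ∈ φ.support, _), ← hφ, ← Finset.sum_add_distrib, Finset.mul_sum]
    refine Finset.sum_congr rfl fun s' hs' => ?_
    have hne : (E s : ℂ) - (E s' : ℂ) ≠ 0 := by
      rw [sub_ne_zero]
      intro h
      have h2 := hE.injective (Complex.ofReal_injective h)
      exact hs (h2 ▸ hs')
    field_simp
    ring
  refine memℓp_gen ?_
  refine summable_of_isBigO_nat hsum ?_
  have h2 := (hO.norm_left).pow 2
  simpa using h2
end

section
/- Let ψ ∈ ℓ²(ℕ, ℂ). Then (a) for every s ∈ ℕ, the family s' ↦ ψ(s')/(E(s) − E(s')) over s' ≠ s is absolutely summable; and (b) for every finitely supported φ : ℕ → ℂ, ∑_s conj(ψ(s)) · ( i·∑_{s'≠s} φ(s')/(E(s) − E(s')) ) = ∑_s conj( i·∑_{s'≠s} ψ(s')/(E(s) − E(s')) ) · φ(s), where the outer sum on the right is a finite sum over the support of φ. (This computes the adjoint pairing ⟨ψ, T₁φ⟩ = ⟨ψ*, φ⟩ with ψ*(s) = i·∑_{s'≠s} ψ(s')/(E(s) − E(s')).) -/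
theorem aux_summable (E : ℕ → ℝ) (hEpos : ∀ s, 0 < E s)
    (hsum : Summable fun s => 1 / (E s) ^ 2) (ψ : lp (fun _ : ℕ => ℂ) 2) (s : ℕ) :
    Summable fun s' : ℕ => ‖ψ s' / ((E s : ℂ) - (E s' : ℂ))‖ := by
  have h2 : Summable fun s' : ℕ => ‖ψ s'‖ ^ 2 := by
    have := (lp.memℓp ψ).summable (by norm_num)
    simpa using this
  have hev : ∀ᶠ s' in Filter.atTop, 1 / (E s') ^ 2 < 1 / (2 * E s) ^ 2 := by
    refine hsum.tendsto_atTop_zero.eventually_lt_const ?_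
    have := hEpos s
    positivity
  refine Summable.of_norm_bounded_eventually_nat (h2.add (hsum.mul_left 4)) ?_
  filter_upwards [hev] with s' h
  have hs := hEpos s
  have hs' := hEpos s'
  have h3 : 2 * E s < E s' := by
    rw [one_div_lt_one_div (by positivity) (by positivity)] at h
    exact lt_of_pow_lt_pow_left₀ 2 hs'.le h
  rw [norm_norm, norm_div, ← Complex.ofReal_sub, Complex.norm_real, Real.norm_eq_abs,
    abs_sub_comm, abs_of_pos (by linarith)]
  have h4 : ‖ψ s'‖ / (E s' - E s) ≤ ‖ψ s'‖ / (E s' / 2) :=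
    div_le_div_of_nonneg_left (norm_nonneg _) (by positivity) (by linarith)
  have h5 : ‖ψ s'‖ / (E s' / 2) = 2 * ‖ψ s'‖ * (1 / E s') := by
    field_simp
  have h6 : 1 / (E s') ^ 2 = (1 / E s') ^ 2 := by
    rw [one_div_pow]
  rw [h6]
  rw [h5] at h4
  nlinarith [sq_nonneg (‖ψ s'‖ - 1 / E s'), sq_nonneg (1 / E s')]


/-- Let `ψ ∈ ℓ²(ℕ, ℂ)`. Then (a) for every `s`, the family
`s' ↦ ψ(s')/(E(s) − E(s'))` over `s' ≠ s` is absolutely summable; and (b) for every finitely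
supported `φ`, `⟨ψ, T₁φ⟩ = ⟨ψ*, φ⟩` with `ψ*(s) = i·∑_{s'≠s} ψ(s')/(E(s) − E(s'))`. -/
theorem stmt7 (E : ℕ → ℝ) (hE : StrictMono E) (hEpos : ∀ s, 0 < E s)
    (hsum : Summable fun s => 1 / (E s) ^ 2) (ψ : lp (fun _ : ℕ => ℂ) 2) :
    (∀ s : ℕ, Summable fun s' : {s' : ℕ // s' ≠ s} =>
      ‖ψ (s' : ℕ) / ((E s : ℂ) - (E (s' : ℕ) : ℂ))‖) ∧
    ∀ φ : ℕ →₀ ℂ,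
      (∑' s : ℕ, (starRingEnd ℂ) (ψ s) *
          (Complex.I * ∑ s' ∈ φ.support.erase s, φ s' / ((E s : ℂ) - (E s' : ℂ)))) =
        ∑ s ∈ φ.support, (starRingEnd ℂ)
          (Complex.I * ∑' s' : {s' : ℕ // s' ≠ s},
            ψ (s' : ℕ) / ((E s : ℂ) - (E (s' : ℕ) : ℂ))) * φ s := by
  have key := aux_summable E hEpos hsum ψ
  refine ⟨fun s => (key s).subtype _, fun φ => ?_⟩
  have hs (s : ℕ) : (∑' s' : {s' : ℕ // s' ≠ s}, ψ (s' : ℕ) / ((E s : ℂ) - (E (s' : ℕ) : ℂ)))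
      = ∑' s' : ℕ, ψ s' / ((E s : ℂ) - (E s' : ℂ)) := by
    refine tsum_subtype_eq_of_support_subset (s := {s' | s' ≠ s})
      (f := fun s' : ℕ => ψ s' / ((E s : ℂ) - (E s' : ℂ))) ?_
    intro x hx h
    apply hx
    simp [h]
  have he (s : ℕ) : (∑ s' ∈ φ.support.erase s, φ s' / ((E s : ℂ) - (E s' : ℂ)))
      = ∑ s' ∈ φ.support, φ s' / ((E s : ℂ) - (E s' : ℂ)) :=
    Finset.sum_erase _ (by simp)
  have hterm (s' s : ℕ) : (starRingEnd ℂ) (ψ s) * (Complex.I * (φ s' / ((E s : ℂ) - (E s' : ℂ))))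
      = (starRingEnd ℂ) (Complex.I * (ψ s / ((E s' : ℂ) - (E s : ℂ)))) * φ s' := by
    simp only [map_mul, map_div₀, map_sub, Complex.conj_ofReal, Complex.conj_I]
    rw [← neg_sub (E s : ℂ) (E s' : ℂ), div_neg]
    ring
  have hsm (s' : ℕ) : HasSum (fun s : ℕ =>
      (starRingEnd ℂ) (Complex.I * (ψ s / ((E s' : ℂ) - (E s : ℂ)))) * φ s')
      ((starRingEnd ℂ) (Complex.I * ∑' s : ℕ, ψ s / ((E s' : ℂ) - (E s : ℂ))) * φ s') := by
    have h := ((key s').of_norm.hasSum.mul_left Complex.I)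
    exact (Complex.hasSum_conj'.mpr (by simpa using h)).mul_right _
  simp only [hs, he, Finset.mul_sum, hterm]
  exact (hasSum_sum fun s' _ => hsm s').tsum_eq
end

section
/- Let α : ℕ → ℝ be a bounded sequence of real numbers and let φ : ℕ → ℂ be finitely supported with ∑_s φ(s) = 0. Then for every s ∈ ℕ, (T_{1,α}(H₁φ))(s) − E(s)·(T_{1,α}φ)(s) = i·φ(s), where (T_{1,α}φ)(s) = i·∑_{s'≠s} φ(s')/(E(s) − E(s')) + α(s)·φ(s) and (H₁φ)(s) = E(s)·φ(s). That is, every member T_{1,α} of the class generated by the characteristic time operator is canonically conjugate with the Hamiltonian on the same dense subspace. -/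
/-- Let `α : ℕ → ℝ` be bounded and `φ : ℕ → ℂ` finitely supported with
`∑_s φ(s) = 0`. Then for every `s`, `(T_{1,α}(H₁φ))(s) − E(s)·(T_{1,α}φ)(s) = i·φ(s)`, where
`(T_{1,α}φ)(s) = i·∑_{s'≠s} φ(s')/(E(s) − E(s')) + α(s)·φ(s)` and `(H₁φ)(s) = E(s)·φ(s)`. -/
theorem stmt11 (E : ℕ → ℝ) (hE : StrictMono E) (hEpos : ∀ s, 0 < E s)
    (α : ℕ → ℝ) (hα : ∃ A : ℝ, ∀ s, |α s| ≤ A)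
    (φ : ℕ →₀ ℂ) (hφ : ∑ s ∈ φ.support, φ s = 0) (s : ℕ) :
    (Complex.I * (∑ s' ∈ φ.support.erase s, (E s' : ℂ) * φ s' / ((E s : ℂ) - (E s' : ℂ))) +
        (α s : ℂ) * ((E s : ℂ) * φ s)) -
      (E s : ℂ) * (Complex.I * (∑ s' ∈ φ.support.erase s, φ s' / ((E s : ℂ) - (E s' : ℂ))) +
        (α s : ℂ) * φ s) =
      Complex.I * φ s := by
  have h1 : ∑ s' ∈ φ.support.erase s, φ s' = - φ s := by
    by_cases hs : s ∈ φ.support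
    · have := Finset.add_sum_erase φ.support (fun t => φ t) hs
      rw [hφ] at this
      linear_combination this
    · rw [Finset.erase_eq_of_notMem hs, hφ, Finsupp.notMem_support_iff.mp hs, neg_zero]
  have h2 : ∑ s' ∈ φ.support.erase s, (E s' : ℂ) * φ s' / ((E s : ℂ) - (E s' : ℂ)) =
      (E s : ℂ) * (∑ s' ∈ φ.support.erase s, φ s' / ((E s : ℂ) - (E s' : ℂ))) -
        ∑ s' ∈ φ.support.erase s, φ s' := by
    rw [Finset.mul_sum, ← Finset.sum_sub_distrib]
    refine Finset.sum_congr rfl fun t ht => ?_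
    have hne : (E s : ℂ) - (E t : ℂ) ≠ 0 := by
      rw [sub_ne_zero]
      intro h
      exact (Finset.ne_of_mem_erase ht) (hE.injective (Complex.ofReal_injective h)).symm
    field_simp
    ring
  rw [h2, h1]
  ring
end

section
/- Let M ≥ 1 and index the Hilbert space by ℕ × Fin M. For every finitely supported φ : ℕ × Fin M → ℂ, the function (s, r) ↦ i·∑_{(s',r') : s'≠s, r'≠r} φ(s', r')/(E(s) − E(s')) (a finite sum over the support of φ) is square-summable, i.e. defines an element of ℓ²(ℕ × Fin M, ℂ). Hence the characteristic time operator T_M for the M-fold degenerate Hamiltonian maps the finitely supported vectors into the Hilbert space. -/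
theorem summable_shift_aux (E : ℕ → ℝ) (hEpos : ∀ s, 0 < E s)
    (hsum : Summable fun s => 1 / (E s) ^ 2) (c : ℝ) (hc : 0 < c) :
    Summable fun s => 1 / (E s - c) ^ 2 := by
  have hev : ∀ᶠ s in Filter.atTop, 1 / (E s) ^ 2 < 1 / (2 * c) ^ 2 :=
    hsum.tendsto_atTop_zero.eventually_lt_const (by positivity)
  refine Summable.of_norm_bounded_eventually_nat (hsum.mul_left 4) ?_
  filter_upwards [hev] with s hs
  have h0 := hEpos s
  have h1 : (2 * c) ^ 2 < (E s) ^ 2 := lt_of_one_div_lt_one_div (by positivity) hs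
  have h2 : 2 * c < E s := lt_of_pow_lt_pow_left₀ 2 h0.le h1
  have h3 : 0 < E s - c := by linarith
  rw [Real.norm_of_nonneg (by positivity), mul_one_div, div_le_div_iff₀ (by positivity) (by positivity)]
  nlinarith

/-- Let `M ≥ 1`. For every finitely supported `φ : ℕ × Fin M → ℂ`, the function
`(s, r) ↦ i·∑_{(s',r') : s'≠s, r'≠r} φ(s', r')/(E(s) − E(s'))` is square-summable, i.e.
defines an element of `ℓ²(ℕ × Fin M, ℂ)`. -/
theorem stmt13 (E : ℕ → ℝ) (hE : StrictMono E) (hEpos : ∀ s, 0 < E s)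
    (hsum : Summable fun s => 1 / (E s) ^ 2) (M : ℕ) (hM : 1 ≤ M)
    (φ : (ℕ × Fin M) →₀ ℂ) :
    Memℓp (fun p : ℕ × Fin M => Complex.I *
      ∑ q ∈ φ.support.filter (fun q => q.1 ≠ p.1 ∧ q.2 ≠ p.2),
        φ q / ((E p.1 : ℂ) - (E q.1 : ℂ))) 2 := by
  refine Memℓp.const_mul (f := fun p : ℕ × Fin M =>
      ∑ q ∈ φ.support.filter (fun q => q.1 ≠ p.1 ∧ q.2 ≠ p.2),
        φ q / ((E p.1 : ℂ) - (E q.1 : ℂ))) ?_ Complex.I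
  simp only [Finset.sum_filter]
  refine Memℓp.finsetSum φ.support (f := fun q (p : ℕ × Fin M) =>
    if q.1 ≠ p.1 ∧ q.2 ≠ p.2 then φ q / ((E p.1 : ℂ) - (E q.1 : ℂ)) else 0) ?_
  intro q _
  refine memℓp_gen ?_
  have hs := summable_shift_aux E hEpos hsum (E q.1) (hEpos _)
  have hp : Summable fun p : ℕ × Fin M => 1 / (E p.1 - E q.1) ^ 2 * (1 : ℝ) :=
    hs.mul_of_nonneg (g := fun _ : Fin M => (1 : ℝ)) (Summable.of_finite)
      (fun s => by simp only [Pi.zero_apply]; positivity) (fun _ => zero_le_one)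
  refine Summable.of_nonneg_of_le (fun p => by positivity) (fun p => ?_) (hp.mul_left (‖φ q‖ ^ 2))
  simp only [ENNReal.toReal_ofNat, Real.rpow_ofNat]
  split_ifs
  · rw [norm_div, div_pow, ← Complex.ofReal_sub, Complex.norm_real, Real.norm_eq_abs, sq_abs]
    apply le_of_eq; ring
  · rw [norm_zero, zero_pow two_ne_zero]; positivity
end

section
/- Let M ≥ 1. In ℓ²(ℕ × Fin M, ℂ), the linear span of the set of vectors { δ_{(i,k)} − δ_{(j,k)} : i, j ∈ ℕ, i ≠ j, k ∈ Fin M }, where δ_{(i,k)} denotes the standard basis vector lp.single 2 (i,k) 1, is dense: its topological closure is the whole space. -/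
/-- Let `M ≥ 1`. In `ℓ²(ℕ × Fin M, ℂ)`, the linear span of the set of vectors
`{ δ_{(i,k)} − δ_{(j,k)} : i ≠ j, k ∈ Fin M }` is dense. -/
theorem stmt14 (M : ℕ) (hM : 1 ≤ M) :
    closure ((Submodule.span ℂ
        {v : lp (fun _ : ℕ × Fin M => ℂ) 2 | ∃ (i j : ℕ) (k : Fin M), i ≠ j ∧
          v = lp.single 2 (i, k) (1 : ℂ) - lp.single 2 (j, k) (1 : ℂ)} :
        Submodule ℂ (lp (fun _ : ℕ × Fin M => ℂ) 2)) :
      Set (lp (fun _ : ℕ × Fin M => ℂ) 2)) = Set.univ := by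
  rw [← Submodule.topologicalClosure_coe]
  rw [(Submodule.topologicalClosure_eq_top_iff).2, Submodule.top_coe]
  rw [Submodule.eq_bot_iff]
  intro x hx
  have h1 : ∀ (i j : ℕ) (k : Fin M), i ≠ j → x (i, k) = x (j, k) := by
    intro i j k hij
    have h := (Submodule.mem_orthogonal _ _).1 hx _ (Submodule.subset_span ⟨i, j, k, hij, rfl⟩)
    rw [inner_sub_left, lp.inner_single_left, lp.inner_single_left] at h
    simpa [sub_eq_zero] using h
  have hs : Summable fun p : ℕ × Fin M => ‖x p‖ ^ (2 : ENNReal).toReal :=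
    (memℓp_gen_iff (by norm_num)).1 (lp.memℓp x)
  ext ⟨i, k⟩
  have hs2 : Summable fun n : ℕ => ‖x (n, k)‖ ^ (2 : ENNReal).toReal :=
    hs.comp_injective (i := fun n : ℕ => (n, k)) (fun a b hab => (Prod.mk.inj hab).1)
  have he : (fun n : ℕ => ‖x (n, k)‖ ^ (2 : ENNReal).toReal)
      = fun _ => ‖x (i, k)‖ ^ (2 : ENNReal).toReal := by
    funext n
    by_cases hn : n = i
    · rw [hn]
    · rw [h1 n i k hn]
  rw [he, summable_const_iff] at hs2
  simpa using hs2
end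

section
/- Suppose in addition that the family (s, s') ↦ 1/(E(s) − E(s'))², taken over all pairs with s ≠ s', is summable with sum S. Then for every finitely supported φ : ℕ → ℂ, ∑_s | i·∑_{s'≠s} φ(s')/(E(s) − E(s')) |² ≤ S · ∑_s |φ(s)|²; that is, ‖T₁φ‖ ≤ S^{1/2}·‖φ‖, so the characteristic time operator is bounded. -/
/-- Suppose the family `(s, s') ↦ 1/(E(s) − E(s'))²` over pairs with `s ≠ s'`
is summable with sum `S`. Then for every finitely supported `φ : ℕ → ℂ`,
`∑_s |i·∑_{s'≠s} φ(s')/(E(s) − E(s'))|² ≤ S·∑_s |φ(s)|²`, i.e. `‖T₁φ‖ ≤ √S·‖φ‖`, so the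
characteristic time operator is bounded. -/
theorem stmt17 (E : ℕ → ℝ) (hE : StrictMono E) (hEpos : ∀ s, 0 < E s) (S : ℝ)
    (hS : HasSum (fun p : {p : ℕ × ℕ // p.1 ≠ p.2} => 1 / (E p.1.1 - E p.1.2) ^ 2) S)
    (φ : ℕ →₀ ℂ) :
    Summable (fun s : ℕ =>
      ‖Complex.I * ∑ s' ∈ φ.support.erase s, φ s' / ((E s : ℂ) - (E s' : ℂ))‖ ^ 2) ∧
    (∑' s : ℕ,
        ‖Complex.I * ∑ s' ∈ φ.support.erase s, φ s' / ((E s : ℂ) - (E s' : ℂ))‖ ^ 2) ≤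
      S * ∑ s ∈ φ.support, ‖φ s‖ ^ 2 := by
  set g : ℕ × ℕ → ℝ := fun p => 1 / (E p.1 - E p.2) ^ 2 with hg
  have hg0 : ∀ p, 0 ≤ g p := fun p => by simp only [hg]; positivity
  have hgS : HasSum g S := by
    have hsub : Function.support g ⊆ {p : ℕ × ℕ | p.1 ≠ p.2} := by
      intro p hp h
      apply hp
      simp [hg, h]
    exact (hasSum_subtype_iff_of_support_subset hsub).1 hS
  have hfac : ∀ s, Summable (fun s' => g (s, s')) := fun s => hgS.summable.prod_factor s
  have ha : HasSum (fun s => ∑' s', g (s, s')) S :=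
    hgS.prod_fiberwise (fun s => (hfac s).hasSum)
  set P : ℝ := ∑ s ∈ φ.support, ‖φ s‖ ^ 2 with hP
  have hP0 : 0 ≤ P := by positivity
  have key : ∀ s : ℕ,
      ‖Complex.I * ∑ s' ∈ φ.support.erase s, φ s' / ((E s : ℂ) - (E s' : ℂ))‖ ^ 2 ≤
        (∑' s', g (s, s')) * P := by
    intro s
    have h1 : ‖Complex.I * ∑ s' ∈ φ.support.erase s, φ s' / ((E s : ℂ) - (E s' : ℂ))‖ ≤
        ∑ s' ∈ φ.support.erase s, ‖φ s'‖ * |E s - E s'|⁻¹ := by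
      rw [norm_mul, Complex.norm_I, one_mul]
      refine (norm_sum_le _ _).trans (le_of_eq (Finset.sum_congr rfl fun s' _ => ?_))
      rw [norm_div, ← Complex.ofReal_sub, Complex.norm_real, Real.norm_eq_abs, div_eq_mul_inv]
    have h2 : (∑ s' ∈ φ.support.erase s, ‖φ s'‖ ^ 2) ≤ P :=
      Finset.sum_le_sum_of_subset_of_nonneg (Finset.erase_subset _ _)
        (fun _ _ _ => by positivity)
    have h3 : (∑ s' ∈ φ.support.erase s, (|E s - E s'|⁻¹) ^ 2) ≤ ∑' s', g (s, s') := by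
      have h4 : (∑ s' ∈ φ.support.erase s, (|E s - E s'|⁻¹) ^ 2) =
          ∑ s' ∈ φ.support.erase s, g (s, s') :=
        Finset.sum_congr rfl fun s' _ => by simp [hg, inv_pow, sq_abs]
      rw [h4]
      exact (hfac s).sum_le_tsum _ (fun _ _ => hg0 _)
    calc _ ≤ (∑ s' ∈ φ.support.erase s, ‖φ s'‖ * |E s - E s'|⁻¹) ^ 2 := by gcongr
      _ ≤ (∑ s' ∈ φ.support.erase s, ‖φ s'‖ ^ 2) *
          (∑ s' ∈ φ.support.erase s, (|E s - E s'|⁻¹) ^ 2) :=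
        Finset.sum_mul_sq_le_sq_mul_sq _ _ _
      _ ≤ P * ∑' s', g (s, s') := by gcongr
      _ = _ := mul_comm _ _
  have hb := ha.mul_right P
  have hsum := Summable.of_nonneg_of_le (fun s => by positivity) key hb.summable
  exact ⟨hsum, hasSum_le key hsum.hasSum hb⟩
end

section
/- If the family (s, s') ↦ 1/(E(s) − E(s'))², taken over all pairs with s ≠ s', is summable, then the series ∑_s 1/(E(s))² converges, i.e. Summable (fun s => 1/(E s)^2). (The condition ∑'_{s≠s'} (E_s − E_{s'})^{-2} < ∞ automatically implies the condition ∑_s E_s^{-2} < ∞ required for the construction of the characteristic time operator.) -/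
/-- If the family `(s, s') ↦ 1/(E(s) − E(s'))²` over pairs with `s ≠ s'` is
summable, then the series `∑_s 1/(E(s))²` converges. -/
theorem stmt19 (E : ℕ → ℝ) (hE : StrictMono E) (hEpos : ∀ s, 0 < E s)
    (hsum : Summable fun p : {p : ℕ × ℕ // p.1 ≠ p.2} => 1 / (E p.1.1 - E p.1.2) ^ 2) :
    Summable fun s => 1 / (E s) ^ 2 := by
  let i : ℕ → {p : ℕ × ℕ // p.1 ≠ p.2} := fun n => ⟨(n + 1, 0), Nat.succ_ne_zero n⟩
  have hinj : Function.Injective i := by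
    intro a b h
    have h' : a + 1 = b + 1 := congrArg (fun p => p.1.1) h
    omega
  have h1 := hsum.comp_injective hinj
  have h2 : Summable fun n : ℕ => 1 / (E (n + 1)) ^ 2 := by
    refine Summable.of_nonneg_of_le (fun n => ?_) (fun n => ?_) h1
    · exact one_div_nonneg.mpr (sq_nonneg _)
    · have h2 : E 0 < E (n + 1) := hE (Nat.succ_pos n)
      have h3 := hEpos 0
      have h4 : 0 < E (n + 1) - E 0 := by linarith
      have h5 : 1 / (E (n + 1)) ^ 2 ≤ 1 / (E (n + 1) - E 0) ^ 2 :=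
        one_div_le_one_div_of_le (pow_pos h4 2) (pow_le_pow_left₀ h4.le (by linarith) 2)
      exact h5
  exact (summable_nat_add_iff (f := fun s => 1 / (E s) ^ 2) 1).mp h2
end
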